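/- Let (Ω,𝒜,P) be a probability space, 𝒢 and ℋ sub-σ-algebras of 𝒜, and set α(𝒢,ℋ) = sup { |P(A∩B) − P(A)P(B)| : A ∈ 𝒢, B ∈ ℋ }. Let δ > 0 and let X be a 𝒢-measurable real random variable and Y an ℋ-measurable real random variable with E[|X|^{2+δ}] < ∞ and E[|Y|^{2+δ}] < ∞. Then |E[XY] − E[X]E[Y]| ≤ 8 · α(𝒢,ℋ)^{δ/(2+δ)} · (E[|X|^{2+δ}])^{1/(2+δ)} · (E[|Y|^{2+δ}])^{1/(2+δ)}. -/

import Mathlib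

open MeasureTheory Filter

noncomputable section

/-- The α-dependence (strong mixing) coefficient between two sub-σ-algebras:
`α(G,H) = sup { |P(A∩B) − P(A)P(B)| : A ∈ G, B ∈ H }`. -/
def alphaDep {Ω : Type*} [MeasurableSpace Ω] (P : Measure Ω)
    (G H : MeasurableSpace Ω) : ℝ :=
  sSup {r : ℝ | ∃ A B : Set Ω, MeasurableSet[G] A ∧ MeasurableSet[H] B ∧
    r = |(P (A ∩ B)).toReal - (P A).toReal * (P B).toReal|}

theorem alphaDep_bdd {Ω : Type*} (G H : MeasurableSpace Ω) {m0 : MeasurableSpace Ω} (P : Measure Ω) [IsProbabilityMeasure P]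
     :
    BddAbove {r : ℝ | ∃ A B : Set Ω, MeasurableSet[G] A ∧ MeasurableSet[H] B ∧
    r = |(P (A ∩ B)).toReal - (P A).toReal * (P B).toReal|} := by
  refine ⟨1, ?_⟩
  rintro r ⟨A, B, -, -, rfl⟩
  have h1 : (P (A ∩ B)).toReal ≤ 1 := measureReal_le_one
  have h2 : (P A).toReal ≤ 1 := measureReal_le_one
  have h3 : (P B).toReal ≤ 1 := measureReal_le_one
  have h4 : 0 ≤ (P (A ∩ B)).toReal := ENNReal.toReal_nonneg
  have h5 : 0 ≤ (P A).toReal := ENNReal.toReal_nonneg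
  have h6 : 0 ≤ (P B).toReal := ENNReal.toReal_nonneg
  rw [abs_le]
  constructor <;> nlinarith

theorem le_alphaDep {Ω : Type*} (G H : MeasurableSpace Ω) {m0 : MeasurableSpace Ω} (P : Measure Ω) [IsProbabilityMeasure P]
     (A B : Set Ω) (hA : MeasurableSet[G] A) (hB : MeasurableSet[H] B) :
    |(P (A ∩ B)).toReal - (P A).toReal * (P B).toReal| ≤ @alphaDep Ω m0 P G H :=
  le_csSup (alphaDep_bdd G H P) ⟨A, B, hA, hB, rfl⟩

theorem alphaDep_nonneg' {Ω : Type*} (G H : MeasurableSpace Ω) {m0 : MeasurableSpace Ω} (P : Measure Ω)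
    [IsProbabilityMeasure P]  : 0 ≤ @alphaDep Ω m0 P G H :=
  (abs_nonneg _).trans (le_alphaDep G H P ∅ ∅ (@MeasurableSet.empty _ G) (@MeasurableSet.empty _ H))

/-- sign function of a set -/
def sgnSet {Ω : Type*} (A : Set Ω) : Ω → ℝ := fun ω => 2 * A.indicator (fun _ => (1:ℝ)) ω - 1

theorem sgnSet_abs {Ω : Type*} (A : Set Ω) (ω : Ω) : |sgnSet A ω| ≤ 1 := by
  by_cases h : ω ∈ A <;> simp [sgnSet, h] <;> norm_num

theorem sgnSet_meas {Ω : Type*} {G : MeasurableSpace Ω} (A : Set Ω) (hA : MeasurableSet[G] A) :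
    Measurable[G] (sgnSet A) := by
  unfold sgnSet
  exact ((measurable_const.indicator hA).const_mul 2).sub_const 1

theorem int_bdd {Ω : Type*} {m0 : MeasurableSpace Ω} (P : Measure Ω) [IsProbabilityMeasure P]
    {Z : Ω → ℝ} (hZ : Measurable Z) (a : ℝ) (h : ∀ ω, |Z ω| ≤ a) : Integrable Z P :=
  Integrable.of_bound hZ.aestronglyMeasurable a (Eventually.of_forall h)

theorem cov_eq_condExp {Ω : Type*} (G : MeasurableSpace Ω) {m0 : MeasurableSpace Ω} (P : Measure Ω)
    [IsProbabilityMeasure P]  (hG : G ≤ m0)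
    (Z W : Ω → ℝ) (hZ : Measurable[G] Z) (a : ℝ) (hZa : ∀ ω, |Z ω| ≤ a) (hW : Integrable W P) :
    (∫ ω, Z ω * W ω ∂P) - (∫ ω, Z ω ∂P) * ∫ ω, W ω ∂P
      = ∫ ω, Z ω * ((P[W|G]) ω - ∫ ω, W ω ∂P) ∂P := by
  have hZm : Measurable Z := hZ.mono hG le_rfl
  have hZi := int_bdd P hZm a hZa
  have hZW : Integrable (Z * W) P :=
    hW.bdd_mul (c := a) hZm.aestronglyMeasurable (Eventually.of_forall hZa)
  have hZC : Integrable (fun ω => Z ω * (P[W|G]) ω) P :=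
    integrable_condExp.bdd_mul (c := a) hZm.aestronglyMeasurable (Eventually.of_forall hZa)
  have h1 := condExp_mul_of_stronglyMeasurable_left (μ := P) hZ.stronglyMeasurable hZW hW
  have h2 : ∫ ω, Z ω * W ω ∂P = ∫ ω, Z ω * (P[W|G]) ω ∂P := by
    have := integral_condExp (μ := P) (f := Z * W) hG
    rw [integral_congr_ae h1] at this
    exact this.symm
  simp_rw [mul_sub]
  rw [integral_sub hZC (hZi.mul_const _), integral_mul_const, h2]

theorem cov_step {Ω : Type*} (G : MeasurableSpace Ω) {m0 : MeasurableSpace Ω} (P : Measure Ω)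
    [IsProbabilityMeasure P]  (hG : G ≤ m0)
    (Z W : Ω → ℝ) (hZ : Measurable[G] Z) (a : ℝ) (hZa : ∀ ω, |Z ω| ≤ a) (hW : Integrable W P) :
    ∃ A, MeasurableSet[G] A ∧ |(∫ ω, Z ω * W ω ∂P) - (∫ ω, Z ω ∂P) * ∫ ω, W ω ∂P|
      ≤ a * |(∫ ω, sgnSet A ω * W ω ∂P) - (∫ ω, sgnSet A ω ∂P) * ∫ ω, W ω ∂P| := by
  have hV : Integrable (fun ω => (P[W|G]) ω - ∫ ω, W ω ∂P) P :=
    integrable_condExp.sub (integrable_const _)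
  have hVm : Measurable[G] (fun ω => (P[W|G]) ω - ∫ ω, W ω ∂P) :=
    (stronglyMeasurable_condExp.measurable).sub_const _
  refine ⟨{ω | 0 ≤ (P[W|G]) ω - ∫ ω, W ω ∂P}, hVm measurableSet_Ici, ?_⟩
  set A := {ω | 0 ≤ (P[W|G]) ω - ∫ ω, W ω ∂P} with hAdef
  have hA : MeasurableSet[G] A := hVm measurableSet_Ici
  have ha : 0 ≤ a := by
    obtain ⟨ω⟩ := P.nonempty_of_neZero
    exact (abs_nonneg _).trans (hZa ω)
  rw [cov_eq_condExp G P hG Z W hZ a hZa hW,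
    cov_eq_condExp G P hG _ W (sgnSet_meas A hA) 1 (sgnSet_abs A) hW]
  have h1 : ∀ ω, sgnSet A ω * ((P[W|G]) ω - ∫ ω, W ω ∂P) = |(P[W|G]) ω - ∫ ω, W ω ∂P| := by
    intro ω
    by_cases h : ω ∈ A
    · have h' : 0 ≤ (P[W|G]) ω - ∫ ω, W ω ∂P := h
      rw [abs_of_nonneg h']; simp [sgnSet, h]; ring
    · have h' : ¬ 0 ≤ (P[W|G]) ω - ∫ ω, W ω ∂P := h
      rw [abs_of_neg (not_le.mp h')]; simp [sgnSet, h]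
  simp_rw [h1]
  calc _ ≤ ∫ ω, |Z ω * ((P[W|G]) ω - ∫ ω, W ω ∂P)| ∂P := abs_integral_le_integral_abs
    _ ≤ ∫ ω, a * |(P[W|G]) ω - ∫ ω, W ω ∂P| ∂P := by
        apply integral_mono_of_nonneg (Eventually.of_forall fun _ => abs_nonneg _)
          (hV.abs.const_mul a)
        refine Eventually.of_forall fun ω => ?_
        simp only [abs_mul]
        exact mul_le_mul_of_nonneg_right (hZa ω) (abs_nonneg _)
    _ = a * ∫ ω, |(P[W|G]) ω - ∫ ω, W ω ∂P| ∂P := integral_const_mul _ _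
    _ ≤ _ := mul_le_mul_of_nonneg_left (le_abs_self _) ha

theorem cov_sgn {Ω : Type*} {m0 : MeasurableSpace Ω} (P : Measure Ω)
    [IsProbabilityMeasure P] (A B : Set Ω) (hA : MeasurableSet A) (hB : MeasurableSet B) :
    (∫ ω, sgnSet B ω * sgnSet A ω ∂P) - (∫ ω, sgnSet B ω ∂P) * ∫ ω, sgnSet A ω ∂P
      = 4 * ((P (A ∩ B)).toReal - (P A).toReal * (P B).toReal) := by
  have iA : ∀ A : Set Ω, MeasurableSet A → Integrable (A.indicator (fun _ => (1:ℝ))) P :=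
    fun A hA => (integrable_const 1).indicator hA
  have e : ∀ A : Set Ω, MeasurableSet A → ∫ ω, A.indicator (fun _ => (1:ℝ)) ω ∂P = (P A).toReal := by
    intro A hA
    rw [integral_indicator hA]; simp [Measure.real]
  have e1 : ∀ A : Set Ω, MeasurableSet A → ∫ ω, sgnSet A ω ∂P = 2 * (P A).toReal - 1 := by
    intro A hA
    unfold sgnSet
    rw [integral_sub ((iA A hA).const_mul 2) (integrable_const _), integral_const_mul, e A hA]
    simp
  have e2 : ∀ ω, sgnSet B ω * sgnSet A ω = 4 * (A ∩ B).indicator (fun _ => (1:ℝ)) ω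
      - sgnSet A ω - sgnSet B ω - 1 := by
    intro ω
    by_cases h : ω ∈ A <;> by_cases h' : ω ∈ B <;> simp [sgnSet, h, h'] <;> norm_num
  have iS : ∀ A : Set Ω, MeasurableSet A → Integrable (sgnSet A) P := fun A hA =>
    int_bdd P (sgnSet_meas A hA) 1 (sgnSet_abs A)
  simp_rw [e2]
  rw [integral_sub, integral_sub, integral_sub, integral_const_mul, e _ (hA.inter hB), e1 A hA,
    e1 B hB]
  · simp; ring
  · exact (iA _ (hA.inter hB)).const_mul 4
  · exact iS A hA
  · exact ((iA _ (hA.inter hB)).const_mul 4).sub (iS A hA)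
  · exact iS B hB
  · exact (((iA _ (hA.inter hB)).const_mul 4).sub (iS A hA)).sub (iS B hB)
  · exact integrable_const _

theorem cov_bdd {Ω : Type*} (G H : MeasurableSpace Ω) {m0 : MeasurableSpace Ω} (P : Measure Ω)
    [IsProbabilityMeasure P]  (hG : G ≤ m0) (hH : H ≤ m0)
    (Z W : Ω → ℝ) (hZ : Measurable[G] Z) (hW : Measurable[H] W) (a : ℝ)
    (hZa : ∀ ω, |Z ω| ≤ a) (hWa : ∀ ω, |W ω| ≤ a) :
    |(∫ ω, Z ω * W ω ∂P) - (∫ ω, Z ω ∂P) * ∫ ω, W ω ∂P| ≤ 4 * @alphaDep Ω m0 P G H * a ^ 2 := by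
  have ha : 0 ≤ a := by
    obtain ⟨ω⟩ := P.nonempty_of_neZero
    exact (abs_nonneg _).trans (hZa ω)
  obtain ⟨A, hA, h1⟩ := cov_step G P hG Z W hZ a hZa (int_bdd P (hW.mono hH le_rfl) a hWa)
  obtain ⟨B, hB, h2⟩ := cov_step H P hH W (sgnSet A) hW a hWa
    (int_bdd P ((sgnSet_meas A hA).mono hG le_rfl) 1 (sgnSet_abs A))
  rw [cov_sgn P A B (hG _ hA) (hH _ hB), abs_mul] at h2
  have h3 := le_alphaDep G H P A B hA hB
  have h4 : |(∫ ω, sgnSet A ω * W ω ∂P) - (∫ ω, sgnSet A ω ∂P) * ∫ ω, W ω ∂P|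
      ≤ a * (4 * @alphaDep Ω m0 P G H) := by
    simp_rw [mul_comm (sgnSet A _)]
    rw [mul_comm (∫ ω, sgnSet A ω ∂P)]
    refine h2.trans ?_
    rw [abs_of_pos (by norm_num : (0:ℝ) < 4)]
    gcongr
  calc _ ≤ _ := h1
    _ ≤ a * (a * (4 * @alphaDep Ω m0 P G H)) := by gcongr
    _ = _ := by ring

theorem young_trunc (p a x y : ℝ) (hp : 2 < p) (ha : 0 < a) (hx : x = 0 ∨ a ≤ x) (hy : 0 ≤ y) :
    x * y ≤ a ^ (2 - p) * ((1 - 1/p) * x ^ p + 1/p * y ^ p) := by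
  have hp0 : 0 < p := by linarith
  have hq : 0 ≤ 1 - 1/p := by
    rw [sub_nonneg, div_le_one hp0]; linarith
  rcases hx with rfl | hx
  · rw [Real.zero_rpow hp0.ne']
    have : 0 ≤ y ^ p := Real.rpow_nonneg hy _
    simp; positivity
  have hx0 : 0 < x := ha.trans_le hx
  have hc : p.HolderConjugate (p/(p-1)) := Real.HolderConjugate.conjExponent (by linarith)
  have h := Real.young_inequality_of_nonneg (a := y/a) (b := x/a) (by positivity) (by positivity) hc
  have hu : (1:ℝ) ≤ x/a := by rwa [one_le_div ha]
  have h2 : (x/a) ^ (p/(p-1)) ≤ (x/a)^p := by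
    apply Real.rpow_le_rpow_of_exponent_le hu
    rw [div_le_iff₀ (by linarith)]; nlinarith
  have h3 : (x/a) ^ (p/(p-1)) / (p/(p-1)) ≤ (1 - 1/p) * (x/a)^p := by
    have : (x/a) ^ (p/(p-1)) / (p/(p-1)) = (1 - 1/p) * (x/a) ^ (p/(p-1)) := by
      have : p - 1 ≠ 0 := by linarith
      field_simp
    rw [this]; gcongr
  have h4 : y/a * (x/a) ≤ (1-1/p) * (x/a)^p + 1/p * (y/a)^p := by
    have : (y/a)^p/p = 1/p * (y/a)^p := by ring
    linarith
  rw [Real.div_rpow hx0.le ha.le, Real.div_rpow hy ha.le] at h4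
  have h5 : a ^ (2-p) = a^2 / a^p := by
    rw [Real.rpow_sub ha]; norm_num
  have hap : 0 < a ^ p := Real.rpow_pos_of_pos ha _
  have h6 := mul_le_mul_of_nonneg_left h4 (sq_nonneg a)
  rw [h5]
  calc x * y = a^2 * (y/a*(x/a)) := by field_simp
    _ ≤ _ := h6
    _ = _ := by field_simp

/-- covariance remainder bound -/
theorem cov_rem {Ω : Type*} {m0 : MeasurableSpace Ω} (P : Measure Ω)
    [IsProbabilityMeasure P] (p a : ℝ) (hp : 2 < p) (ha : 0 < a) (U V F K : Ω → ℝ)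
    (hU : ∀ ω, U ω = 0 ∨ a ≤ |U ω|) (hUF : ∀ ω, |U ω| ≤ |F ω|) (hVK : ∀ ω, |V ω| ≤ |K ω|)
    (hF : Integrable (fun ω => |F ω| ^ p) P) (hK : Integrable (fun ω => |K ω| ^ p) P)
    (hUi : Integrable U P) (hVi : Integrable V P)
    (hF1 : ∫ ω, |F ω| ^ p ∂P ≤ 1) (hK1 : ∫ ω, |K ω| ^ p ∂P ≤ 1) :
    |(∫ ω, U ω * V ω ∂P) - (∫ ω, U ω ∂P) * ∫ ω, V ω ∂P| ≤ 2 * a ^ (2 - p) := by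
  have hp0 : 0 < p := by linarith
  have hq : 0 ≤ 1 - 1/p := by
    rw [sub_nonneg, div_le_one hp0]; linarith
  have hap : 0 < a ^ (2 - p) := Real.rpow_pos_of_pos ha _
  have key : ∀ ω ω', |U ω| * |V ω'| ≤
      a ^ (2 - p) * ((1 - 1/p) * |F ω| ^ p + 1/p * |K ω'| ^ p) := by
    intro ω ω'
    refine (young_trunc p a |U ω| |V ω'| hp ha ?_ (abs_nonneg _)).trans ?_
    · rcases hU ω with h | h
      · left; simp [h]
      · right; exact h
    · have := Real.rpow_le_rpow (abs_nonneg _) (hUF ω) hp0.le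
      have := Real.rpow_le_rpow (abs_nonneg _) (hVK ω') hp0.le
      gcongr
  have fin : a ^ (2 - p) * ((1 - 1/p) * (∫ ω, |F ω| ^ p ∂P) + 1/p * ∫ ω, |K ω| ^ p ∂P)
      ≤ a ^ (2 - p) := by
    have h1 := mul_le_mul_of_nonneg_left hF1 hq
    have h2 := mul_le_mul_of_nonneg_left hK1 (by positivity : 0 ≤ 1/p)
    nlinarith
  have b1 : |∫ ω, U ω * V ω ∂P| ≤ a ^ (2 - p) := by
    refine le_trans ?_ fin
    calc _ ≤ ∫ ω, |U ω * V ω| ∂P := abs_integral_le_integral_abs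
      _ ≤ ∫ ω, a ^ (2 - p) * ((1 - 1/p) * |F ω| ^ p + 1/p * |K ω| ^ p) ∂P := by
        apply integral_mono_of_nonneg (Eventually.of_forall fun _ => abs_nonneg _)
        · exact ((hF.const_mul _).add (hK.const_mul _)).const_mul _
        · refine Eventually.of_forall fun ω => ?_
          simp only [abs_mul]
          exact key ω ω
      _ = _ := by
        rw [integral_const_mul, integral_add (hF.const_mul _) (hK.const_mul _),
          integral_const_mul, integral_const_mul]
  have b2 : |(∫ ω, U ω ∂P) * ∫ ω, V ω ∂P| ≤ a ^ (2 - p) := by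
    refine le_trans ?_ fin
    have s1 : ∀ ω, |U ω| * (∫ ω', |V ω'| ∂P) ≤
        a ^ (2 - p) * ((1 - 1/p) * |F ω| ^ p + 1/p * ∫ ω', |K ω'| ^ p ∂P) := by
      intro ω
      have := integral_mono (hVi.abs.const_mul |U ω|)
        (((integrable_const ((1 - 1/p) * |F ω| ^ p)).add (hK.const_mul (1/p))).const_mul
          (a ^ (2 - p))) (fun ω' => key ω ω')
      rw [integral_const_mul, integral_const_mul] at this
      simp only [Pi.add_apply] at this
      rw [integral_add (integrable_const _) (hK.const_mul _), integral_const_mul (1/p)] at this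
      simpa using this
    have s2 := integral_mono (hUi.abs.mul_const (∫ ω', |V ω'| ∂P))
        (((hF.const_mul (1 - 1/p)).add (integrable_const (1/p * ∫ ω', |K ω'| ^ p ∂P))).const_mul
          (a ^ (2 - p))) s1
    rw [integral_mul_const, integral_const_mul] at s2
    simp only [Pi.add_apply] at s2
    rw [integral_add (hF.const_mul _) (integrable_const _), integral_const_mul] at s2
    rw [abs_mul]
    calc _ ≤ (∫ ω, |U ω| ∂P) * ∫ ω, |V ω| ∂P := by
          gcongr
          · exact abs_integral_le_integral_abs
          · exact abs_integral_le_integral_abs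
      _ ≤ _ := by simpa using s2
  calc _ ≤ |∫ ω, U ω * V ω ∂P| + |(∫ ω, U ω ∂P) * ∫ ω, V ω ∂P| := abs_sub _ _
    _ ≤ _ := by linarith

def trc (a : ℝ) (x : ℝ) : ℝ := if |x| ≤ a then x else 0

theorem trc_meas (a : ℝ) : Measurable (trc a) :=
  Measurable.ite (measurableSet_le measurable_id.abs measurable_const) measurable_id measurable_const

theorem cov_norm {Ω : Type*} (G H : MeasurableSpace Ω) {m0 : MeasurableSpace Ω} (P : Measure Ω)
    [IsProbabilityMeasure P]  (hG : G ≤ m0) (hH : H ≤ m0)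
    (p : ℝ) (hp : 2 < p) (a : ℝ) (ha : 0 < a)
    (X Y : Ω → ℝ) (hX : Measurable[G] X) (hY : Measurable[H] Y)
    (hXm : Integrable (fun ω => |X ω| ^ p) P) (hYm : Integrable (fun ω => |Y ω| ^ p) P)
    (hX1 : ∫ ω, |X ω| ^ p ∂P ≤ 1) (hY1 : ∫ ω, |Y ω| ^ p ∂P ≤ 1) :
    |(∫ ω, X ω * Y ω ∂P) - (∫ ω, X ω ∂P) * ∫ ω, Y ω ∂P|
      ≤ 4 * @alphaDep Ω m0 P G H * a ^ 2 + 4 * a ^ (2 - p) := by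
  have ml : ∀ Z : Ω → ℝ, Measurable Z → Integrable (fun ω => |Z ω| ^ p) P → MemLp Z 2 P := by
    intro Z hZ hZp
    have h : MemLp Z (ENNReal.ofReal p) P := by
      rw [← integrable_norm_rpow_iff hZ.aestronglyMeasurable
        (p := ENNReal.ofReal p) (by simp; linarith) (by simp)]
      rw [ENNReal.toReal_ofReal (by linarith)]
      exact hZp
    refine h.mono_exponent ?_
    rw [show (2:ENNReal) = ENNReal.ofReal 2 by simp]
    exact ENNReal.ofReal_le_ofReal hp.le
  have hXM := hX.mono hG le_rfl
  have hYM := hY.mono hH le_rfl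
  have X2 := ml X hXM hXm
  have Y2 := ml Y hYM hYm
  have tle : ∀ x, |trc a x| ≤ a := by
    intro x; unfold trc; split_ifs with h
    · exact h
    · simpa using ha.le
  have tle' : ∀ x, |trc a x| ≤ |x| := by
    intro x; unfold trc; split_ifs with h <;> simp
  have rle : ∀ x, |x - trc a x| ≤ |x| := by
    intro x; unfold trc; split_ifs with h <;> simp
  have ror : ∀ x, x - trc a x = 0 ∨ a ≤ |x - trc a x| := by
    intro x; unfold trc; split_ifs with h
    · simp
    · right; simpa using (not_le.mp h).le
  have tX : MemLp (fun ω => trc a (X ω)) 2 P := X2.mono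
    ((trc_meas a).comp hXM).aestronglyMeasurable (Eventually.of_forall fun ω => tle' _)
  have tY : MemLp (fun ω => trc a (Y ω)) 2 P := Y2.mono
    ((trc_meas a).comp hYM).aestronglyMeasurable (Eventually.of_forall fun ω => tle' _)
  have rX := X2.sub tX
  have rY := Y2.sub tY
  have i {Z : Ω → ℝ} (h : MemLp Z 2 P) : Integrable Z P := h.integrable (by norm_num)
  have c0 := cov_bdd G H P hG hH (fun ω => trc a (X ω)) (fun ω => trc a (Y ω))
    ((trc_meas a).comp hX) ((trc_meas a).comp hY) a (fun _ => tle _) (fun _ => tle _)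
  have c1 := cov_rem P p a hp ha (fun ω => X ω - trc a (X ω)) Y X Y (fun ω => ror _)
    (fun ω => rle _) (fun ω => le_rfl) hXm hYm (i rX) (i Y2) hX1 hY1
  have c2 := cov_rem P p a hp ha (fun ω => Y ω - trc a (Y ω)) (fun ω => trc a (X ω)) Y X
    (fun ω => ror _) (fun ω => rle _) (fun ω => tle' _) hYm hXm (i rY) (i tX) hY1 hX1
  have j {Z W : Ω → ℝ} (h : MemLp Z 2 P) (h' : MemLp W 2 P) :
    Integrable (fun ω => Z ω * W ω) P := h.integrable_mul h'
  simp only [sub_mul] at c1 c2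
  rw [integral_sub (j X2 Y2) (j tX Y2), integral_sub (i X2) (i tX)] at c1
  rw [integral_sub (j Y2 tX) (j tY tX), integral_sub (i Y2) (i tY)] at c2
  simp_rw [mul_comm (Y _), mul_comm (trc a (Y _))] at c2
  rw [abs_le] at *
  constructor <;> nlinarith

theorem cov_norm' {Ω : Type*} (G H : MeasurableSpace Ω) {m0 : MeasurableSpace Ω} (P : Measure Ω)
    [IsProbabilityMeasure P]  (hG : G ≤ m0) (hH : H ≤ m0)
    (p : ℝ) (hp : 2 < p)
    (X Y : Ω → ℝ) (hX : Measurable[G] X) (hY : Measurable[H] Y)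
    (hXm : Integrable (fun ω => |X ω| ^ p) P) (hYm : Integrable (fun ω => |Y ω| ^ p) P)
    (hX1 : ∫ ω, |X ω| ^ p ∂P ≤ 1) (hY1 : ∫ ω, |Y ω| ^ p ∂P ≤ 1) :
    |(∫ ω, X ω * Y ω ∂P) - (∫ ω, X ω ∂P) * ∫ ω, Y ω ∂P|
      ≤ 8 * (@alphaDep Ω m0 P G H) ^ ((p - 2) / p) := by
  have hp0 : 0 < p := by linarith
  have he : 0 < (p - 2) / p := div_pos (by linarith) hp0
  set α := @alphaDep Ω m0 P G H with hα
  have hα0 : 0 ≤ α := alphaDep_nonneg' G H P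
  have main : ∀ β, α < β → |(∫ ω, X ω * Y ω ∂P) - (∫ ω, X ω ∂P) * ∫ ω, Y ω ∂P|
      ≤ 8 * β ^ ((p - 2) / p) := by
    intro β hβ
    have hβ0 : 0 < β := hα0.trans_lt hβ
    refine (cov_norm G H P hG hH p hp (β ^ (-1/p)) (by positivity) X Y hX hY hXm hYm hX1 hY1).trans ?_
    have e1 : (β ^ (-1/p)) ^ (2 - p) = β ^ ((p-2)/p) := by
      rw [← Real.rpow_mul hβ0.le]; congr 1; ring
    have e2 : β * (β ^ (-1/p)) ^ 2 = β ^ ((p-2)/p) := by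
      rw [← Real.rpow_natCast, ← Real.rpow_mul hβ0.le]
      nth_rewrite 1 [← Real.rpow_one β]
      rw [← Real.rpow_add hβ0]; congr 1; push_cast; field_simp; ring
    have e3 : α * (β ^ (-1/p)) ^ 2 ≤ β * (β ^ (-1/p)) ^ 2 := by gcongr
    rw [← hα, e1]
    linarith
  have ht : Tendsto (fun β : ℝ => 8 * β ^ ((p - 2) / p)) (nhdsWithin α (Set.Ioi α))
      (nhds (8 * α ^ ((p - 2) / p))) :=
    (((Real.continuous_rpow_const he.le).const_mul 8).tendsto α).mono_left nhdsWithin_le_nhds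
  exact ge_of_tendsto ht (eventually_mem_nhdsWithin.mono fun β hβ => main β hβ)

theorem ae_zero_of_mom {Ω : Type*} {m0 : MeasurableSpace Ω} (P : Measure Ω) (p : ℝ) (hp : 0 < p)
    (X : Ω → ℝ) (hXm : Integrable (fun ω => |X ω| ^ p) P) (h : ∫ ω, |X ω| ^ p ∂P = 0) :
    X =ᵐ[P] 0 := by
  rw [integral_eq_zero_iff_of_nonneg (fun ω => Real.rpow_nonneg (abs_nonneg _) _) hXm] at h
  filter_upwards [h] with ω hω
  simpa [Real.rpow_eq_zero (abs_nonneg (X ω)) hp.ne'] using hω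

theorem cov_final
    {Ω : Type*} (G H : MeasurableSpace Ω) {m0 : MeasurableSpace Ω} (P : Measure Ω) [IsProbabilityMeasure P]
     (hG : G ≤ m0) (hH : H ≤ m0)
    (δ : ℝ) (hδ : 0 < δ)
    (X Y : Ω → ℝ) (hX : @Measurable Ω ℝ G Real.measurableSpace X)
    (hY : @Measurable Ω ℝ H Real.measurableSpace Y)
    (hXmom : Integrable (fun ω => |X ω| ^ ((2 : ℝ) + δ)) P)
    (hYmom : Integrable (fun ω => |Y ω| ^ ((2 : ℝ) + δ)) P) :
    |(∫ ω, X ω * Y ω ∂P) - (∫ ω, X ω ∂P) * ∫ ω, Y ω ∂P|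
      ≤ 8 * (@alphaDep Ω m0 P G H) ^ (δ / ((2 : ℝ) + δ))
        * (∫ ω, |X ω| ^ ((2 : ℝ) + δ) ∂P) ^ (1 / ((2 : ℝ) + δ))
        * (∫ ω, |Y ω| ^ ((2 : ℝ) + δ) ∂P) ^ (1 / ((2 : ℝ) + δ)) := by
  have hp0 : 0 < 2 + δ := by linarith
  have hα0 := alphaDep_nonneg' G H P
  have n0 : ∀ Z : Ω → ℝ, 0 ≤ ∫ ω, |Z ω| ^ (2 + δ) ∂P := fun Z =>
    integral_nonneg fun ω => Real.rpow_nonneg (abs_nonneg _) _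
  have R0 : 0 ≤ 8 * (@alphaDep Ω m0 P G H) ^ (δ / ((2 : ℝ) + δ))
        * (∫ ω, |X ω| ^ ((2 : ℝ) + δ) ∂P) ^ (1 / ((2 : ℝ) + δ))
        * (∫ ω, |Y ω| ^ ((2 : ℝ) + δ) ∂P) ^ (1 / ((2 : ℝ) + δ)) := by
    have := n0 X
    have := n0 Y
    positivity
  rcases (n0 X).eq_or_lt with hx | hx
  · have hz := ae_zero_of_mom P _ hp0 X hXmom hx.symm
    have h1 : ∫ ω, X ω ∂P = 0 := integral_eq_zero_of_ae hz
    have h2 : ∫ ω, X ω * Y ω ∂P = 0 := integral_eq_zero_of_ae (by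
      filter_upwards [hz] with ω h; simp [h])
    rw [h1, h2]; simpa using R0
  rcases (n0 Y).eq_or_lt with hy | hy
  · have hz := ae_zero_of_mom P _ hp0 Y hYmom hy.symm
    have h1 : ∫ ω, Y ω ∂P = 0 := integral_eq_zero_of_ae hz
    have h2 : ∫ ω, X ω * Y ω ∂P = 0 := integral_eq_zero_of_ae (by
      filter_upwards [hz] with ω h; simp [h])
    rw [h1, h2]; simpa using R0
  clear R0
  have sc : ∀ Z : Ω → ℝ, 0 < ∫ ω, |Z ω| ^ (2 + δ) ∂P → ∀ ω,
      |((∫ ω, |Z ω| ^ (2 + δ) ∂P) ^ (1 / (2 + δ)))⁻¹ * Z ω| ^ (2 + δ)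
        = (∫ ω, |Z ω| ^ (2 + δ) ∂P)⁻¹ * |Z ω| ^ (2 + δ) := by
    intro Z hZ ω
    have hN : 0 < (∫ ω, |Z ω| ^ (2 + δ) ∂P) ^ (1 / (2 + δ)) := Real.rpow_pos_of_pos hZ _
    rw [abs_mul, abs_of_pos (inv_pos.2 hN), Real.mul_rpow (inv_pos.2 hN).le (abs_nonneg _),
      Real.inv_rpow hN.le, ← Real.rpow_mul hZ.le, one_div_mul_cancel hp0.ne', Real.rpow_one]
  set N := (∫ ω, |X ω| ^ ((2 : ℝ) + δ) ∂P) ^ (1 / ((2 : ℝ) + δ)) with hN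
  set M := (∫ ω, |Y ω| ^ ((2 : ℝ) + δ) ∂P) ^ (1 / ((2 : ℝ) + δ)) with hM
  have N0 : 0 < N := Real.rpow_pos_of_pos hx _
  have M0 : 0 < M := Real.rpow_pos_of_pos hy _
  have sX := sc X hx
  have sY := sc Y hy
  have key := cov_norm' G H P hG hH (2 + δ) (by linarith) (fun ω => N⁻¹ * X ω) (fun ω => M⁻¹ * Y ω)
    (hX.const_mul _) (hY.const_mul _)
    (by simp only [hN, sX]; exact hXmom.const_mul _)
    (by simp only [hM, sY]; exact hYmom.const_mul _)
    (by simp only [hN, sX]; rw [integral_const_mul, inv_mul_cancel₀ hx.ne'])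
    (by simp only [hM, sY]; rw [integral_const_mul, inv_mul_cancel₀ hy.ne'])
  have e : ∀ ω, N⁻¹ * X ω * (M⁻¹ * Y ω) = (N * M)⁻¹ * (X ω * Y ω) := by
    intro ω; rw [mul_inv]; ring
  simp_rw [e] at key
  rw [integral_const_mul, integral_const_mul, integral_const_mul,
    show ∀ a b c : ℝ, (N*M)⁻¹ * a - N⁻¹ * b * (M⁻¹ * c) = (N*M)⁻¹ * (a - b * c) by
      intro a b c; rw [mul_inv]; ring, abs_mul, abs_of_pos (by positivity : 0 < (N*M)⁻¹),
    inv_mul_le_iff₀ (by positivity), add_sub_cancel_left] at key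
  calc _ ≤ _ := key
    _ = _ := by ring

/-- covariance inequality for strongly mixing σ-algebras:
if `X` is `G`-measurable and `Y` is `H`-measurable, both with finite `2+δ`
moments, then
`|E[XY] − E[X]E[Y]| ≤ 8 α(G,H)^{δ/(2+δ)} ‖X‖_{2+δ} ‖Y‖_{2+δ}`. -/
theorem covariance_mixing_inequality
    {Ω : Type*} [m0 : MeasurableSpace Ω] (P : Measure Ω) [IsProbabilityMeasure P]
    (G H : MeasurableSpace Ω) (hG : G ≤ m0) (hH : H ≤ m0)
    (δ : ℝ) (hδ : 0 < δ)
    (X Y : Ω → ℝ) (hX : @Measurable Ω ℝ G Real.measurableSpace X)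
    (hY : @Measurable Ω ℝ H Real.measurableSpace Y)
    (hXmom : Integrable (fun ω => |X ω| ^ ((2 : ℝ) + δ)) P)
    (hYmom : Integrable (fun ω => |Y ω| ^ ((2 : ℝ) + δ)) P) :
    |(∫ ω, X ω * Y ω ∂P) - (∫ ω, X ω ∂P) * ∫ ω, Y ω ∂P|
      ≤ 8 * (@alphaDep Ω m0 P G H) ^ (δ / ((2 : ℝ) + δ))
        * (∫ ω, |X ω| ^ ((2 : ℝ) + δ) ∂P) ^ (1 / ((2 : ℝ) + δ))
        * (∫ ω, |Y ω| ^ ((2 : ℝ) + δ) ∂P) ^ (1 / ((2 : ℝ) + δ)) := by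
  exact cov_final G H P hG hH δ hδ X Y hX hY hXmom hYmom
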